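/- arXiv:2212.01955 — 3 statements merged into one kernel-verified Lean document; each statement's English description precedes it below -/
import Mathlib

section
/- For every four-digit positive integer n (1000 ≤ n ≤ 9999), either there exists k ≤ 13 with f^[k](n) = 0, or there exists k ≤ 4 with f^[k](n) ∈ {2178, -6534, -2178, 6534}. -/
/-- Reverse the decimal digits of a natural number. -/
def rev (m : ℕ) : ℕ := Nat.ofDigits 10 (Nat.digits 10 m).reverse

/-- The reflection of an integer: reverse its digits and flip its sign. -/
def reflect (a : ℤ) : ℤ := if 0 ≤ a then -(rev a.toNat : ℤ) else (rev (-a).toNat : ℤ)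

/-- The reflective step map. -/
def f (a : ℤ) : ℤ := a + reflect a

def R (m : ℕ) : ℕ :=
  if m < 10 then m else if m < 100 then m % 10 * 10 + m / 10
  else if m < 1000 then m % 10 * 100 + m / 10 % 10 * 10 + m / 100
  else m % 10 * 1000 + m / 10 % 10 * 100 + m / 100 % 10 * 10 + m / 1000

def G (m : ℕ) : ℕ := (m - R m) + (R m - m)

def chk : ℕ → ℕ → Bool
  | 0, v => v == 0
  | k + 1, v => match v with
    | 0 => true
    | j + 1 => chk k (G (j + 1))

def cyc : ℕ → ℕ → Bool
  | 0, v => v == 2178 || v == 6534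
  | k + 1, v => v == 2178 || v == 6534 || match v with
    | 0 => false
    | j + 1 => cyc k (G (j + 1))

theorem rev_eq (m : ℕ) (h : m < 10000) : rev m = R m := by
  unfold rev R
  rcases Nat.eq_zero_or_pos m with rfl | h0
  · simp
  split_ifs with h1 h2 h3
  · rw [Nat.digits_of_lt 10 m (by omega) h1]; simp
  · rw [Nat.digits_def' (by norm_num) h0, Nat.digits_of_lt 10 (m / 10) (by omega) (by omega)]
    simp [Nat.ofDigits_cons]; omega
  · rw [Nat.digits_def' (by norm_num) h0, Nat.digits_def' (by norm_num) (by omega),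
      Nat.digits_of_lt 10 (m / 10 / 10) (by omega) (by omega)]
    simp [Nat.ofDigits_cons]; omega
  · rw [Nat.digits_def' (by norm_num) h0, Nat.digits_def' (by norm_num) (by omega),
      Nat.digits_def' (by norm_num) (by omega),
      Nat.digits_of_lt 10 (m / 10 / 10 / 10) (by omega) (by omega)]
    have e1 : m / 10 / 10 = m / 100 := by omega
    have e2 : m / 100 / 10 = m / 1000 := by omega
    rw [e1, e2]
    simp only [List.reverse_cons, List.reverse_nil, List.nil_append, List.cons_append,
      Nat.ofDigits_cons, Nat.ofDigits_nil]
    ring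

theorem R_lt (m : ℕ) (h : m < 10000) : R m < 10000 := by
  unfold R; split_ifs <;> omega

theorem G_lt (m : ℕ) (h : m < 10000) : G m < 10000 := by
  have := R_lt m h
  unfold G; omega

theorem f_abs (a : ℤ) (h : a.natAbs < 10000) : (f a).natAbs = G a.natAbs := by
  unfold f reflect G
  split_ifs with h0
  · have e : a.toNat = a.natAbs := by omega
    rw [e, rev_eq _ h]; omega
  · have e : (-a).toNat = a.natAbs := by omega
    rw [e, rev_eq _ h]; omega

theorem chk_spec (k : ℕ) : ∀ a : ℤ, a.natAbs < 10000 → chk k a.natAbs = true →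
    ∃ j : ℕ, j ≤ k ∧ f^[j] a = 0 := by
  induction k with
  | zero => intro a _ h; exact ⟨0, le_rfl, by simpa [chk] using h⟩
  | succ k ih =>
    intro a ha h
    by_cases h0 : a = 0
    · exact ⟨0, by omega, by simpa using h0⟩
    · obtain ⟨j, hj⟩ : ∃ j, a.natAbs = j + 1 := ⟨a.natAbs - 1, by omega⟩
      rw [hj] at h
      simp only [chk] at h
      rw [← hj, ← f_abs a ha] at h
      obtain ⟨i, hi, e⟩ := ih (f a) (by rw [f_abs a ha]; exact G_lt _ ha) h
      exact ⟨i + 1, by omega, by simpa using e⟩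

theorem mem_of_abs (a : ℤ) (h : a.natAbs = 2178 ∨ a.natAbs = 6534) :
    a ∈ ({2178, -6534, -2178, 6534} : Set ℤ) := by
  simp only [Set.mem_insert_iff, Set.mem_singleton_iff]; omega

theorem cyc_spec (k : ℕ) : ∀ a : ℤ, a.natAbs < 10000 → cyc k a.natAbs = true →
    ∃ j : ℕ, j ≤ k ∧ f^[j] a ∈ ({2178, -6534, -2178, 6534} : Set ℤ) := by
  induction k with
  | zero => intro a _ h; exact ⟨0, le_rfl, mem_of_abs a (by simpa [cyc] using h)⟩
  | succ k ih =>
    intro a ha h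
    by_cases h0 : a.natAbs = 2178 ∨ a.natAbs = 6534
    · exact ⟨0, by omega, mem_of_abs a h0⟩
    · obtain h1 | ⟨j, hj⟩ : a.natAbs = 0 ∨ ∃ j, a.natAbs = j + 1 := by
        rcases Nat.eq_zero_or_pos a.natAbs with h | h
        · exact Or.inl h
        · exact Or.inr ⟨a.natAbs - 1, by omega⟩
      · rw [h1] at h; simp [cyc] at h
      rw [hj] at h
      simp only [cyc, Bool.or_eq_true, beq_iff_eq] at h
      rw [← hj, ← f_abs a ha] at h
      obtain ⟨i, hi, e⟩ := ih (f a) (by rw [f_abs a ha]; exact G_lt _ ha) (h.resolve_left h0)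
      exact ⟨i + 1, by omega, by simpa using e⟩

theorem table : ∀ x < 19, ∀ y < 19,
    (chk 12 ((999 * x + 90 * y - 9801) + (9801 - (999 * x + 90 * y))) ||
     cyc 3 ((999 * x + 90 * y - 9801) + (9801 - (999 * x + 90 * y)))) = true := by
  decide +kernel

theorem four_digit_limits_bounded (n : ℤ) (h1 : 1000 ≤ n) (h2 : n ≤ 9999) :
    (∃ k : ℕ, k ≤ 13 ∧ f^[k] n = 0) ∨
    (∃ k : ℕ, k ≤ 4 ∧ f^[k] n ∈ ({2178, -6534, -2178, 6534} : Set ℤ)) := by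
  have hn : n.natAbs < 10000 := by omega
  have hg := f_abs n hn
  have hl : (f n).natAbs < 10000 := by rw [hg]; exact G_lt _ hn
  have ht := table (n.natAbs / 1000 + 9 - n.natAbs % 10) (by omega)
    (n.natAbs / 100 % 10 + 9 - n.natAbs / 10 % 10) (by omega)
  have hm : 1000 ≤ n.natAbs := by omega
  generalize n.natAbs = m at *
  have e : ∀ x y, x = m / 1000 + 9 - m % 10 → y = m / 100 % 10 + 9 - m / 10 % 10 →
      (999 * x + 90 * y - 9801) + (9801 - (999 * x + 90 * y)) = G m := by
    intro x y hx hy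
    unfold G R
    rw [if_neg (by omega), if_neg (by omega), if_neg (by omega)]
    have e1 : m / 10 / 10 = m / 100 := by omega
    have e2 : m / 100 / 10 = m / 1000 := by omega
    clear ht hg hl
    have q1 := Nat.div_add_mod m 10
    have q2 := Nat.div_add_mod (m / 10) 10
    have q3 := Nat.div_add_mod (m / 100) 10
    rw [e1] at q2
    rw [e2] at q3
    have l1 := Nat.mod_lt m (show 10 > 0 by norm_num)
    have l2 := Nat.mod_lt (m / 10) (show 10 > 0 by norm_num)
    have l3 := Nat.mod_lt (m / 100) (show 10 > 0 by norm_num)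
    clear e1 e2
    generalize m % 10 = d at *
    generalize m / 10 % 10 = c at *
    generalize m / 100 % 10 = b at *
    generalize m / 1000 = a at *
    generalize m / 100 = p at *
    generalize m / 10 = q at *
    omega
  rw [e _ _ rfl rfl, ← hg, Bool.or_eq_true] at ht
  rcases ht with h | h
  · obtain ⟨i, hi, e⟩ := chk_spec 12 (f n) hl h
    exact Or.inl ⟨i + 1, by omega, by simpa using e⟩
  · obtain ⟨i, hi, e⟩ := cyc_spec 3 (f n) hl h
    exact Or.inr ⟨i + 1, by omega, by simpa using e⟩
end

section
/- For every six-digit positive integer n (100000 ≤ n ≤ 999999), there exists k such that f^[k](n) equals 0, 2178, 21978, or 219978; that is, every six-digit number reaches the zero limit or one of the cycles generated by 2178, 21978, or 219978. -/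
/-- Evaluate a natural number before passing it on. -/
def forceN {α : Type} (n : ℕ) (k : ℕ → α) : α :=
  Nat.rec (k 0) (fun m _ => k (m + 1)) n

theorem forceN_eq {α : Type} (n : ℕ) (k : ℕ → α) : forceN n k = k n := by
  cases n <;> rfl

/-- Fast digit reversal with an accumulator. -/
def revAux (fuel : ℕ) : ℕ → ℕ → ℕ :=
  Nat.rec (fun _ acc => acc)
    (fun _ ih m acc => Bool.rec
      (forceN (m / 10) fun q => forceN (10 * acc + m % 10) fun a => ih q a) acc (Nat.beq m 0))
    fuel

theorem revAux_succ (fuel m acc : ℕ) : revAux (fuel + 1) m acc =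
    if m = 0 then acc else revAux fuel (m / 10) (10 * acc + m % 10) := by
  change (Bool.rec (forceN (m / 10) fun q => forceN (10 * acc + m % 10) fun a => revAux fuel q a)
    acc (Nat.beq m 0) : ℕ) = _
  rw [forceN_eq, forceN_eq]
  cases m <;> rfl

theorem revAux_eq (fuel : ℕ) : ∀ m acc : ℕ, m < 10 ^ fuel →
    revAux fuel m acc = Nat.ofDigits 10 ((Nat.digits 10 m).reverse)
      + 10 ^ (Nat.digits 10 m).length * acc := by
  induction fuel with
  | zero =>
    intro m acc h
    have : m = 0 := by simpa using h
    subst this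
    simp [revAux]
  | succ k ih =>
    intro m acc h
    rw [revAux_succ]
    split_ifs with h0
    · subst h0; simp
    · rw [ih _ _ (by rw [pow_succ] at h; omega),
        Nat.digits_def' (by norm_num) (Nat.pos_of_ne_zero h0)]
      simp only [List.reverse_cons, Nat.ofDigits_append, List.length_reverse, List.length_cons,
        Nat.ofDigits_singleton]
      ring

theorem revAux_rev (m : ℕ) (h : m < 10 ^ 6) : revAux 6 m 0 = rev m := by
  rw [revAux_eq 6 m 0 h]; simp [rev]

/-- Iterate the absolute step until a target is reached. -/
def loop (fuel : ℕ) : ℕ → Bool :=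
  Nat.rec (fun _ => false)
    (fun _ ih m =>
      (Nat.beq m 0 || (Nat.beq m 2178 || (Nat.beq m 21978 || Nat.beq m 219978))) ||
      (Nat.blt m 1000000 &&
        forceN (revAux 6 m 0) fun r => forceN ((m - r) + (r - m)) fun d => ih d))
    fuel

theorem loop_succ (fuel m : ℕ) : loop (fuel + 1) m =
    ((Nat.beq m 0 || (Nat.beq m 2178 || (Nat.beq m 21978 || Nat.beq m 219978))) ||
      (Nat.blt m 1000000 &&
        loop fuel ((m - revAux 6 m 0) + (revAux 6 m 0 - m)))) := by
  change ((Nat.beq m 0 || (Nat.beq m 2178 || (Nat.beq m 21978 || Nat.beq m 219978))) ||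
      (Nat.blt m 1000000 &&
        forceN (revAux 6 m 0) fun r => forceN ((m - r) + (r - m)) fun d => loop fuel d)) = _
  rw [forceN_eq, forceN_eq]

def Good (n : ℤ) : Prop :=
  ∃ k : ℕ, f^[k] n = 0 ∨ f^[k] n = 2178 ∨ f^[k] n = 21978 ∨ f^[k] n = 219978

theorem Good.of_step {a : ℤ} (h : Good (f a)) : Good a := by
  obtain ⟨k, hk⟩ := h
  exact ⟨k + 1, by simpa only [Function.iterate_succ_apply] using hk⟩

theorem f_nat (m : ℕ) : f (m : ℤ) = m - rev m := by
  simp [f, reflect, sub_eq_add_neg]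

theorem f_neg (m : ℕ) : f (-(m : ℤ)) = -(m - rev m) := by
  rcases Nat.eq_zero_or_pos m with rfl | h
  · simp [f, reflect, rev]
  · have : ¬ (0 : ℤ) ≤ -(m : ℤ) := by omega
    simp only [f, reflect, this, if_false, neg_neg, Int.toNat_natCast]
    ring

theorem good_target (m : ℕ) (h : m = 0 ∨ m = 2178 ∨ m = 21978 ∨ m = 219978) :
    Good m ∧ Good (-m) := by
  constructor
  · exact ⟨0, by simp only [Function.iterate_zero, id]; omega⟩
  · refine ⟨2, ?_⟩
    simp only [Function.iterate_succ, Function.iterate_zero, Function.comp, id]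
    rcases h with rfl | rfl | rfl | rfl <;> simp [f, reflect, rev, Nat.ofDigits]

theorem loop_good (fuel : ℕ) : ∀ m : ℕ, loop fuel m = true → Good m ∧ Good (-m) := by
  induction fuel with
  | zero => intro m h; exact absurd h (by simp [loop])
  | succ k ih =>
    intro m h
    rw [loop_succ, Bool.or_eq_true] at h
    rcases h with h | h
    · apply good_target
      simpa only [Bool.or_eq_true, Nat.beq_eq] using h
    · rw [Bool.and_eq_true] at h
      obtain ⟨hl, h⟩ := h
      have hl : m < 1000000 := by simpa [Nat.blt] using hl
      rw [revAux_rev m (by norm_num; exact hl)] at h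
      obtain ⟨h1, h2⟩ := ih _ h
      have key : Good ((m : ℤ) - rev m) ∧ Good (-((m : ℤ) - rev m)) := by
        rcases le_total (rev m) m with hle | hle
        · have e : (((m - rev m) + (rev m - m) : ℕ) : ℤ) = (m : ℤ) - rev m := by omega
          rw [e] at h1 h2
          exact ⟨h1, h2⟩
        · have e : (((m - rev m) + (rev m - m) : ℕ) : ℤ) = -((m : ℤ) - rev m) := by omega
          rw [e] at h1 h2
          rw [neg_neg] at h2
          exact ⟨h2, h1⟩
      exact ⟨Good.of_step (by rw [f_nat]; exact key.1), Good.of_step (by rw [f_neg]; exact key.2)⟩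

/-- Bounded check of a Boolean predicate. -/
def allB (n : ℕ) (p : ℕ → Bool) : Bool :=
  Nat.rec true (fun i ih => p i && ih) n

theorem allB_spec (n : ℕ) (p : ℕ → Bool) (h : allB n p = true) : ∀ i < n, p i = true := by
  induction n with
  | zero => intro i hi; omega
  | succ k ih =>
    have h : (p k && allB k p) = true := h
    rw [Bool.and_eq_true] at h
    intro i hi
    rcases Nat.lt_succ_iff_lt_or_eq.mp hi with hi | rfl
    · exact ih h.2 i hi
    · exact h.1

def checkAll : Bool :=
  allB 10 fun x => allB 19 fun y => allB 19 fun z =>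
    forceN (99999 * x + 9990 * y + 900 * z) fun s =>
      forceN ((s - 98010) + (98010 - s)) fun d => loop 60 d

theorem checkAll_true : checkAll = true := by decide +kernel

theorem check_nat (x y z : ℕ) (hx : x < 10) (hy : y < 19) (hz : z < 19) :
    loop 60 ((99999 * x + 9990 * y + 900 * z - 98010)
      + (98010 - (99999 * x + 9990 * y + 900 * z))) = true := by
  have h := allB_spec _ _ (allB_spec _ _ (allB_spec _ _ checkAll_true x hx) y hy) z hz
  simpa only [forceN_eq] using h

theorem good_pos (x y z : ℤ) (hx : 0 ≤ x) (hx' : x ≤ 9) (hy : -9 ≤ y) (hy' : y ≤ 9)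
    (hz : -9 ≤ z) (hz' : z ≤ 9) :
    Good (99999 * x + 9990 * y + 900 * z) ∧ Good (-(99999 * x + 9990 * y + 900 * z)) := by
  have h := loop_good _ _ (check_nat x.toNat (y + 9).toNat (z + 9).toNat
    (by omega) (by omega) (by omega))
  generalize hd : (99999 * x.toNat + 9990 * (y + 9).toNat + 900 * (z + 9).toNat - 98010)
      + (98010 - (99999 * x.toNat + 9990 * (y + 9).toNat + 900 * (z + 9).toNat)) = d at h
  have : (d : ℤ) = 99999 * x + 9990 * y + 900 * z ∨
      (d : ℤ) = -(99999 * x + 9990 * y + 900 * z) := by omega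
  rcases this with e | e
  · rw [e] at h; exact h
  · rw [e, neg_neg] at h; exact ⟨h.2, h.1⟩

theorem good_all (x y z : ℤ) (hx : -9 ≤ x) (hx' : x ≤ 9) (hy : -9 ≤ y) (hy' : y ≤ 9)
    (hz : -9 ≤ z) (hz' : z ≤ 9) : Good (99999 * x + 9990 * y + 900 * z) := by
  rcases le_total 0 x with h | h
  · exact (good_pos x y z h hx' hy hy' hz hz').1
  · have := (good_pos (-x) (-y) (-z) (by omega) (by omega) (by omega) (by omega)
      (by omega) (by omega)).2
    convert this using 1
    ring

theorem rev_six (m : ℕ) (h1 : 100000 ≤ m) (h2 : m ≤ 999999) :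
    rev m = 100000 * (m % 10) + 10000 * (m / 10 % 10) + 1000 * (m / 100 % 10)
      + 100 * (m / 1000 % 10) + 10 * (m / 10000 % 10) + m / 100000 := by
  rw [← revAux_rev m (by norm_num; omega)]
  simp only [revAux_succ, Nat.div_div_eq_div_mul]
  norm_num only
  rw [if_neg (by omega), if_neg (by omega), if_neg (by omega), if_neg (by omega),
    if_neg (by omega), if_neg (by omega)]
  change 10 * _ + _ = _
  omega

theorem six_digit_limits (n : ℤ) (h1 : 100000 ≤ n) (h2 : n ≤ 999999) :
    ∃ k : ℕ, f^[k] n = 0 ∨ f^[k] n = 2178 ∨ f^[k] n = 21978 ∨ f^[k] n = 219978 := by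
  change Good n
  lift n to ℕ using by omega
  apply Good.of_step
  rw [f_nat, rev_six n (by omega) (by omega)]
  have h := good_all ((n / 100000 : ℕ) - (n % 10 : ℕ))
    ((n / 10000 % 10 : ℕ) - (n / 10 % 10 : ℕ)) ((n / 1000 % 10 : ℕ) - (n / 100 % 10 : ℕ))
    (by omega) (by omega) (by omega) (by omega) (by omega) (by omega)
  convert h using 1
  omega
end

section
/- Among the five-digit positive integers n (10000 ≤ n ≤ 99999), exactly 45600 satisfy ∃ k, f^[k](n) = 0, exactly 38030 satisfy ∃ k, f^[k](n) = 2178, and exactly 6370 satisfy ∃ k, f^[k](n) = 21978. -/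
def revF : ℕ → ℕ → ℕ → ℕ
  | 0, m, acc => Nat.ofDigits 10 (Nat.digits 10 m).reverse + acc * 10 ^ (Nat.digits 10 m).length
  | k+1, m, acc => bif Nat.beq m 0 then acc else revF k (m / 10) (acc * 10 + m % 10)

theorem revF_eq (k : ℕ) : ∀ m acc, revF k m acc =
    Nat.ofDigits 10 (Nat.digits 10 m).reverse + acc * 10 ^ (Nat.digits 10 m).length := by
  induction k with
  | zero => intro m acc; rfl
  | succ k ih =>
    intro m acc
    rcases Nat.eq_zero_or_pos m with h | h
    · subst h; simp [revF]
    · have hb : Nat.beq m 0 = false := by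
        cases m with
        | zero => omega
        | succ m => rfl
      rw [revF, hb, cond_false, ih, Nat.digits_def' (by norm_num) h]
      simp only [List.reverse_cons, Nat.ofDigits_append, List.length_reverse, List.length_cons,
        Nat.ofDigits_singleton]
      ring

theorem rev_eq_s13 (k m : ℕ) : rev m = revF k m 0 := by
  rw [revF_eq]; simp [rev]

def ndist (a b : ℕ) : ℕ := (a - b) + (b - a)

def hstep (m : ℕ) : ℕ := ndist m (revF 6 m 0)

theorem f_natAbs (a : ℤ) : (f a).natAbs = hstep a.natAbs := by
  unfold f reflect hstep ndist
  rw [← rev_eq_s13]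
  split_ifs with h
  · have : a.toNat = a.natAbs := by omega
    rw [this]; omega
  · have : (-a).toNat = a.natAbs := by omega
    rw [this]; omega

/-- class: 1, 2, 3 for the limits 0, 2178, 21978; 0 when undecided -/
def cls : ℕ → ℕ → ℕ
  | 0, _ => 0
  | k+1, m => bif Nat.beq m 0 then 1 else bif Nat.beq m 2178 then 2 else
      bif Nat.beq m 21978 then 3 else cls k (hstep m)

def tgt : ℕ → ℕ
  | 1 => 0
  | 2 => 2178
  | _ => 21978

theorem cls_spec (k : ℕ) : ∀ (a : ℤ) (i : ℕ), i ≠ 0 → cls k a.natAbs = i →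
    ∃ j, (f^[j] a).natAbs = tgt i := by
  induction k with
  | zero => intro a i hi h; exact absurd h.symm hi
  | succ k ih =>
    intro a i hi h
    rw [cls] at h
    by_cases h0 : a.natAbs = 0
    · refine ⟨0, ?_⟩
      rw [h0] at h
      have : i = 1 := h.symm
      subst this; simpa [tgt] using h0
    by_cases h1 : a.natAbs = 2178
    · refine ⟨0, ?_⟩
      rw [h1] at h
      have : i = 2 := h.symm
      subst this; simpa [tgt] using h1
    by_cases h2 : a.natAbs = 21978
    · refine ⟨0, ?_⟩
      rw [h2] at h
      have : i = 3 := h.symm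
      subst this; simpa [tgt] using h2
    have e : ∀ x, a.natAbs ≠ x → Nat.beq a.natAbs x = false := fun x hx => by
      rw [← Bool.not_eq_true, Nat.beq_eq]; exact hx
    rw [e _ h0, e _ h1, e _ h2, cond_false, cond_false, cond_false, ← f_natAbs] at h
    obtain ⟨j, hj⟩ := ih _ _ hi h
    exact ⟨j + 1, by simpa using hj⟩

theorem f_iter_natAbs (j : ℕ) (a : ℤ) : (f^[j] a).natAbs = hstep^[j] a.natAbs := by
  induction j generalizing a with
  | zero => rfl
  | succ j ih => rw [Function.iterate_succ_apply, Function.iterate_succ_apply, ih, f_natAbs]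

theorem f_neg2178 : f^[2] (-2178) = 2178 := by
  simp only [Function.iterate_succ_apply, Function.iterate_zero_apply, f, reflect, rev_eq_s13 6]
  decide
theorem f_neg21978 : f^[2] (-21978) = 21978 := by
  simp only [Function.iterate_succ_apply, Function.iterate_zero_apply, f, reflect, rev_eq_s13 6]
  decide

theorem reach (a : ℤ) (i : ℕ) (h : ∃ j, (f^[j] a).natAbs = tgt i) : ∃ j, f^[j] a = tgt i := by
  obtain ⟨j, hj⟩ := h
  rcases Int.natAbs_eq (f^[j] a) with h | h
  · exact ⟨j, by rw [h, hj]⟩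
  · rw [hj] at h
    have h2 : f^[2] (-(tgt i : ℤ)) = tgt i ∨ tgt i = 0 := by
      unfold tgt
      split
      · right; rfl
      · left; exact f_neg2178
      · left; exact f_neg21978
    rcases h2 with h2 | h2
    · exact ⟨2 + j, by rw [Function.iterate_add_apply, h, h2]⟩
    · exact ⟨j, by rw [h, h2]; rfl⟩

def orb : ℕ → ℕ → Prop
  | 1, m => m = 0
  | 2, m => m = 2178 ∨ m = 6534
  | _, m => m = 21978 ∨ m = 65934

theorem orb_step (i m : ℕ) (h : orb i m) : orb i (hstep m) := by
  unfold orb at *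
  split at h
  · subst h; rfl
  · rcases h with h | h <;> subst h <;> decide
  · rcases h with h | h <;> subst h <;> decide

theorem orb_iter (i m j : ℕ) (h : orb i m) : orb i (hstep^[j] m) := by
  induction j with
  | zero => exact h
  | succ j ih => rw [Function.iterate_succ_apply']; exact orb_step _ _ ih

theorem orb_tgt (i : ℕ) : orb i (tgt i) := by
  unfold orb tgt
  split <;> simp

theorem excl (a : ℤ) (i i' : ℕ) (hi : 1 ≤ i ∧ i ≤ 3) (hi' : 1 ≤ i' ∧ i' ≤ 3)
    (h : ∃ j, f^[j] a = tgt i) (h' : ∃ j, f^[j] a = tgt i') : i = i' := by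
  obtain ⟨j, hj⟩ := h
  obtain ⟨j', hj'⟩ := h'
  have e1 : hstep^[j] a.natAbs = tgt i := by rw [← f_iter_natAbs, hj]; rfl
  have e2 : hstep^[j'] a.natAbs = tgt i' := by rw [← f_iter_natAbs, hj']; rfl
  have o1 : orb i (hstep^[j' + j] a.natAbs) := by
    rw [Function.iterate_add_apply, e1]; exact orb_iter _ _ _ (orb_tgt i)
  have o2 : orb i' (hstep^[j' + j] a.natAbs) := by
    rw [add_comm, Function.iterate_add_apply, e2]; exact orb_iter _ _ _ (orb_tgt i')
  obtain ⟨a1, a2⟩ := hi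
  obtain ⟨b1, b2⟩ := hi'
  interval_cases i <;> interval_cases i' <;> simp only [orb] at o1 o2 <;> omega

def sumN : ℕ → (ℕ → ℕ) → ℕ
  | 0, _ => 0
  | n+1, g => sumN n g + g n

theorem sumN_eq (n : ℕ) (g : ℕ → ℕ) : ∑ i ∈ Finset.range n, g i = sumN n g := by
  induction n with
  | zero => rfl
  | succ n ih => rw [Finset.sum_range_succ, ih, sumN]

def kxy (x y : ℕ) : ℕ := cls 20 (ndist (9999 * x + 990 * y) 88902)

def key (a b d e : ℕ) : ℕ := kxy (a + 9 - e) (b + 9 - d)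

theorem hstep_digits (a b c d e : ℕ) (ha : a < 9) (hb : b < 10) (hc : c < 10) (hd : d < 10)
    (he : e < 10) : hstep (10000 * (a + 1) + 1000 * b + 100 * c + 10 * d + e) =
      ndist (9999 * (a + 1) + 990 * b) (9999 * e + 990 * d) := by
  have key : revF 6 (10000 * (a + 1) + 1000 * b + 100 * c + 10 * d + e) 0
      = 10000 * e + 1000 * d + 100 * c + 10 * b + (a + 1) := by
    have st : ∀ k m acc, 0 < m → revF (k+1) m acc = revF k (m / 10) (acc * 10 + m % 10) := by
      intro k m acc hm
      cases m with
      | zero => omega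
      | succ m => rfl
    rw [st _ _ _ (by omega), st _ _ _ (by omega), st _ _ _ (by omega), st _ _ _ (by omega),
      st _ _ _ (by omega)]
    have : (10000 * (a + 1) + 1000 * b + 100 * c + 10 * d + e) / 10 / 10 / 10 / 10 / 10 = 0 := by
      omega
    rw [this]
    show _ * 10 + _ = _
    omega
  unfold hstep
  rw [key]; unfold ndist; omega


def wx (x : ℕ) : ℕ := min (min (x + 1) 9) (18 - x)
def wy (y : ℕ) : ℕ := min (y + 1) (19 - y)

theorem sum_wy (F : ℕ → ℕ) : ∑ b ∈ Finset.range 10, ∑ d ∈ Finset.range 10, F (b + 9 - d) =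
    sumN 19 (fun y => wy y * F y) := by
  simp [Finset.sum_range_succ, sumN, wy]
  ring

theorem sum_wx (F : ℕ → ℕ) : ∑ a ∈ Finset.range 9, ∑ e ∈ Finset.range 10, F (a + 9 - e) =
    sumN 18 (fun x => wx x * F x) := by
  simp [Finset.sum_range_succ, sumN, wx]
  ring

def keyCount (i : ℕ) : ℕ := sumN 18 (fun x => wx x * sumN 19 (fun y =>
    wy y * bif Nat.beq (kxy x y) i then 1 else 0))

theorem keyCount1 : keyCount 1 = 4560 := by decide +kernel
theorem keyCount2 : keyCount 2 = 3803 := by decide +kernel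
theorem keyCount3 : keyCount 3 = 637 := by decide +kernel

theorem cls_le (k : ℕ) : ∀ m, cls k m ≤ 3 := by
  induction k with
  | zero => intro m; exact Nat.zero_le _
  | succ k ih =>
    intro m
    rw [cls]
    cases Nat.beq m 0 <;> cases Nat.beq m 2178 <;> cases Nat.beq m 21978 <;> simp [ih]

abbrev dom : Finset (ℕ × ℕ × ℕ × ℕ × ℕ) :=
  Finset.range 9 ×ˢ Finset.range 10 ×ˢ Finset.range 10 ×ˢ Finset.range 10 ×ˢ Finset.range 10

/-- digits in the order a, b, d, e, c -/
def num (p : ℕ × ℕ × ℕ × ℕ × ℕ) : ℕ :=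
  10000 * (p.1 + 1) + 1000 * p.2.1 + 100 * p.2.2.2.2 + 10 * p.2.2.1 + p.2.2.2.1

def keyP (p : ℕ × ℕ × ℕ × ℕ × ℕ) : ℕ := key p.1 p.2.1 p.2.2.1 p.2.2.2.1

theorem keyP_le (p) : keyP p ≤ 3 := by
  unfold keyP key kxy
  exact cls_le _ _

theorem ndist_shift (X Y P c : ℕ) (h : P + Y = X + c) : ndist X Y = ndist P c := by
  unfold ndist
  omega

theorem card_filter_key (i : ℕ) : (dom.filter (fun p => keyP p = i)).card = 10 * keyCount i := by
  have hb : ∀ x : ℕ, (if x = i then 1 else 0 : ℕ) = bif Nat.beq x i then 1 else 0 := by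
    intro x
    by_cases h : x = i
    · rw [if_pos h, Nat.beq_eq.mpr h]; rfl
    · have : Nat.beq x i = false := by rw [← Bool.not_eq_true, Nat.beq_eq]; exact h
      rw [if_neg h, this]; rfl
  rw [Finset.card_filter]
  rw [Finset.sum_congr rfl (fun p _ => hb (keyP p))]
  simp only [dom, Finset.sum_product, keyP, Finset.sum_const, Finset.card_range, smul_eq_mul,
    ← Finset.mul_sum, keyCount, key]
  refine congrArg (HMul.hMul 10) ?_
  rw [← sum_wx (fun x => sumN 19 (fun y => wy y * bif Nat.beq (kxy x y) i then 1 else 0))]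
  refine Finset.sum_congr rfl (fun a _ => ?_)
  rw [Finset.sum_congr rfl (fun b _ => Finset.sum_comm), Finset.sum_comm]
  refine Finset.sum_congr rfl (fun e _ => ?_)
  exact sum_wy (fun y => bif Nat.beq (kxy (a + 9 - e) y) i then 1 else 0)

attribute [irreducible] keyCount kxy

theorem dom_sum : keyCount 0 + keyCount 1 + keyCount 2 + keyCount 3 = 9000 := by
  have h : dom.card = ∑ i ∈ Finset.range 4, (dom.filter (fun p => keyP p = i)).card := by
    apply Finset.card_eq_sum_card_fiberwise
    intro p _
    have : keyP p ≤ 3 := keyP_le p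
    simp only [Finset.coe_range, Set.mem_Iio]
    exact Nat.lt_succ_of_le this
  simp only [card_filter_key, Finset.sum_range_succ, Finset.sum_range_zero] at h
  have h2 : dom.card = 90000 := by simp [dom]
  omega

theorem keyP_pos (p) (hp : p ∈ dom) : keyP p ≠ 0 := by
  have h0 : keyCount 0 = 0 := by
    have := dom_sum
    have h1 := keyCount1
    have h2 := keyCount2
    have h3 := keyCount3
    omega
  have := card_filter_key 0
  rw [h0, Finset.card_eq_zero, Finset.filter_eq_empty_iff] at this
  exact this hp

theorem reach_key (p) (hp : p ∈ dom) : ∃ j, f^[j] (num p : ℤ) = tgt (keyP p) := by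
  apply reach
  obtain ⟨a, b, d, e, c⟩ := p
  have h0 := keyP_pos _ hp
  simp only [dom, Finset.mem_product, Finset.mem_range] at hp
  have h : cls 20 (f (num (a, b, d, e, c) : ℤ)).natAbs = keyP (a, b, d, e, c) := by
    rw [f_natAbs, Int.natAbs_natCast]
    simp only [num, keyP, key, kxy]
    rw [hstep_digits a b c d e (by omega) (by omega) (by omega) (by omega) (by omega)]
    rw [ndist_shift _ _ (9999 * (a + 9 - e) + 990 * (b + 9 - d)) 88902]
    omega
  obtain ⟨j, hj⟩ := cls_spec 20 _ _ h0 h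
  exact ⟨j + 1, by simpa using hj⟩

theorem set_card (i : ℕ) (hi : 1 ≤ i ∧ i ≤ 3) :
    {n : ℤ | 10000 ≤ n ∧ n ≤ 99999 ∧ ∃ k : ℕ, f^[k] n = (tgt i : ℤ)}.ncard = 10 * keyCount i := by
  rw [← card_filter_key, ← Finset.card_image_of_injOn (f := fun p => (num p : ℤ)),
    ← Set.ncard_coe_finset]
  · congr 1
    ext n
    simp only [Set.mem_ofPred_eq, Finset.coe_image, Set.mem_image, Finset.coe_filter]
    constructor
    · rintro ⟨h1, h2, h3⟩
      obtain ⟨m, rfl⟩ : ∃ m : ℕ, n = m := ⟨n.toNat, by omega⟩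
      have hd : (m / 10000 - 1, m / 1000 % 10, m / 10 % 10, m % 10, m / 100 % 10) ∈ dom := by
        simp only [dom, Finset.mem_product, Finset.mem_range]; omega
      have hn : num (m / 10000 - 1, m / 1000 % 10, m / 10 % 10, m % 10, m / 100 % 10) = m := by
        simp only [num]; omega
      refine ⟨_, ⟨hd, ?_⟩, by rw [hn]⟩
      have h4 := reach_key _ hd
      rw [hn] at h4
      refine excl _ _ _ ⟨Nat.pos_of_ne_zero (keyP_pos _ hd), keyP_le _⟩ hi h4 h3
    · rintro ⟨p, ⟨hd, hk⟩, rfl⟩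
      have h4 := reach_key _ hd
      rw [hk] at h4
      simp only [dom, Finset.mem_product, Finset.mem_range] at hd
      refine ⟨?_, ?_, h4⟩ <;> simp only [num] <;> omega
  · rintro ⟨a, b, d, e, c⟩ hp ⟨a', b', d', e', c'⟩ hp' h
    simp only [dom, Finset.coe_filter, Set.mem_ofPred_eq, Finset.mem_product,
      Finset.mem_range] at hp hp'
    simp only [num] at h
    simp only [Prod.mk.injEq]
    omega

theorem five_digit_counts :
    {n : ℤ | 10000 ≤ n ∧ n ≤ 99999 ∧ ∃ k : ℕ, f^[k] n = 0}.ncard = 45600 ∧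
    {n : ℤ | 10000 ≤ n ∧ n ≤ 99999 ∧ ∃ k : ℕ, f^[k] n = 2178}.ncard = 38030 ∧
    {n : ℤ | 10000 ≤ n ∧ n ≤ 99999 ∧ ∃ k : ℕ, f^[k] n = 21978}.ncard = 6370 := by 
  have h1 := set_card 1 (by omega)
  have h2 := set_card 2 (by omega)
  have h3 := set_card 3 (by omega)
  rw [keyCount1] at h1
  rw [keyCount2] at h2
  rw [keyCount3] at h3
  exact ⟨h1, h2, h3⟩
end
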